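/- Let W be a symmetric positive semidefinite real q×q matrix, G a real q×p matrix, M ∈ ℝ^q, and r > 0. Suppose ρ̂ ∈ ℝ^p minimizes ρ ↦ (M − Gρ)ᵀ W (M − Gρ) + 2r‖ρ‖₁ over ℝ^p, and suppose ρ⋆ ∈ ℝ^p satisfies ‖GᵀWM − GᵀWGρ⋆‖_∞ ≤ r/2. Then ‖ρ̂‖₁ ≤ 3‖ρ⋆‖₁. -/

import Mathlib

open Matrix

theorem dotProduct_le_mul_sum_abs {ι : Type*} [Fintype ι] {c : ℝ} {x : ι → ℝ}
    (hx : ∀ j, |x j| ≤ c) (y : ι → ℝ) : x ⬝ᵥ y ≤ c * ∑ j, |y j| := by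
  rw [dotProduct, Finset.mul_sum]
  refine Finset.sum_le_sum fun j _ => (le_abs_self _).trans ?_
  rw [abs_mul]
  exact mul_le_mul_of_nonneg_right (hx j) (abs_nonneg _)

/-- A positive semidefinite quadratic form lies above its tangent at `u`. -/
theorem quadratic_form_sub_ge {ι : Type*} [Fintype ι] {W : Matrix ι ι ℝ} (hW : W.IsSymm)
    (hpsd : ∀ v : ι → ℝ, 0 ≤ v ⬝ᵥ W *ᵥ v) (u v : ι → ℝ) :
    u ⬝ᵥ W *ᵥ u - 2 * (v ⬝ᵥ W *ᵥ u) ≤ (u - v) ⬝ᵥ W *ᵥ (u - v) := by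
  have hcomm : u ⬝ᵥ W *ᵥ v = v ⬝ᵥ W *ᵥ u := by
    rw [dotProduct_mulVec, ← mulVec_transpose, hW.eq, dotProduct_comm]
  have hv := hpsd v
  simp only [mulVec_sub, sub_dotProduct, dotProduct_sub]
  linarith

/-- Deterministic content of Lemma S.13: if `ρ̂` minimizes
`ρ ↦ (M − Gρ)ᵀ W (M − Gρ) + 2r‖ρ‖₁` with `W` symmetric positive semidefinite, `r > 0`,
and `ρ⋆` satisfies `‖GᵀWM − GᵀWGρ⋆‖_∞ ≤ r/2`, then `‖ρ̂‖₁ ≤ 3‖ρ⋆‖₁`. -/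
theorem pgmm_l1_bound {p q : ℕ}
    (W : Matrix (Fin q) (Fin q) ℝ) (hWsymm : W.IsSymm)
    (hWpsd : ∀ v : Fin q → ℝ, 0 ≤ v ⬝ᵥ W.mulVec v)
    (G : Matrix (Fin q) (Fin p) ℝ) (M : Fin q → ℝ) (r : ℝ) (hr : 0 < r)
    (ρhat : Fin p → ℝ)
    (hmin : ∀ ρ : Fin p → ℝ,
      (M - G.mulVec ρhat) ⬝ᵥ W.mulVec (M - G.mulVec ρhat) + 2 * r * ∑ j, |ρhat j| ≤
        (M - G.mulVec ρ) ⬝ᵥ W.mulVec (M - G.mulVec ρ) + 2 * r * ∑ j, |ρ j|)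
    (ρstar : Fin p → ℝ)
    (hstar : ∀ j, |(Gᵀ.mulVec (W.mulVec M) - (Gᵀ * W * G).mulVec ρstar) j| ≤ r / 2) :
    ∑ j, |ρhat j| ≤ 3 * ∑ j, |ρstar j| := by
  set d := ρhat - ρstar with hd
  have hgrad : Gᵀ *ᵥ (W *ᵥ M) - (Gᵀ * W * G) *ᵥ ρstar = Gᵀ *ᵥ (W *ᵥ (M - G *ᵥ ρstar)) := by
    simp only [mulVec_sub, mulVec_mulVec, Matrix.mul_assoc]
  have hcross : (G *ᵥ d) ⬝ᵥ W *ᵥ (M - G *ᵥ ρstar) ≤ r / 2 * ∑ j, |d j| := by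
    rw [dotProduct_comm, dotProduct_mulVec, ← mulVec_transpose, ← hgrad]
    exact dotProduct_le_mul_sum_abs hstar d
  have hquad := quadratic_form_sub_ge hWsymm hWpsd (M - G *ᵥ ρstar) (G *ᵥ d)
  have hres : M - G *ᵥ ρstar - G *ᵥ d = M - G *ᵥ ρhat := by
    rw [hd, mulVec_sub]
    abel
  rw [hres] at hquad
  have htri : ∑ j, |d j| ≤ ∑ j, |ρhat j| + ∑ j, |ρstar j| := by
    rw [← Finset.sum_add_distrib]
    exact Finset.sum_le_sum fun j _ => abs_sub _ _
  have hmin_star := hmin ρstar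
  refine le_of_mul_le_mul_left ?_ hr
  have hscaled := mul_le_mul_of_nonneg_left htri hr.le
  linarith
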